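/- Let M, m > 0 with m ≠ 2M and g ∈ ℝ. There exist real constants c'_{μν}, d'_{abμν} (0 ≤ a, b ≤ 2, spacetime multi-indices |μ|, |ν| ≤ 1), depending only on M, m, and a smooth function G from the finite-dimensional space of jets ((ζ_μ)_{|μ|≤2}, (ζ'_ν)_{|ν|≤2}) ∈ (ℂ²)^{#\{|μ|≤2\}} × ℝ^{#\{|ν|≤2\}} to ℝ vanishing of cubic order at the origin (G(0) = 0, DG(0) = 0, D²G(0) = 0), such that for every sufficiently smooth solution (ψ, φ) of the Dirac–Klein–Gordon system one has g⟨ψ, βψ⟩_{ℂ²} = (□ + m²)Λ_{KG} + N_{KG} + R_{KG} pointwise, where Λ_{KG} = Σ_{|μ|,|ν|≤1} c'_{μν} ⟨∂^μ ψ, β ∂^ν ψ⟩_{ℂ²}, N_{KG} = Σ_{a,b=0}^{2} Σ_{|μ|,|ν|≤1} d'_{abμν} [ ⟨∂_a∂^μ ψ, β ∂_b∂^ν ψ⟩_{ℂ²} − ⟨∂_b∂^μ ψ, β ∂_a∂^ν ψ⟩_{ℂ²} ], and R_{KG}(t, x) = G((∂^μ ψ(t,x))_{|μ|≤2}, (∂^ν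 φ(t,x))_{|ν|≤2}). -/

import Mathlib

open MeasureTheory Matrix

noncomputable section

/-- Partial derivative `∂_a` on spacetime `ℝ^{1+2}` (coordinates `p 0 = t`, `p 1 = x₁`, `p 2 = x₂`). -/
def pd {E : Type*} [NormedAddCommGroup E] [NormedSpace ℝ E]
    (a : Fin 3) (u : (Fin 3 → ℝ) → E) : (Fin 3 → ℝ) → E :=
  fun p => fderiv ℝ u p (Pi.single a 1)

/-- d'Alembertian `□ = ∂_t² − ∂_1² − ∂_2²`. -/
def Box {E : Type*} [NormedAddCommGroup E] [NormedSpace ℝ E]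
    (u : (Fin 3 → ℝ) → E) : (Fin 3 → ℝ) → E :=
  fun p => pd 0 (pd 0 u) p - pd 1 (pd 1 u) p - pd 2 (pd 2 u) p

/-- Coordinate function with `x₀ = −t`, `x₁`, `x₂`. -/
def Xc (a : Fin 3) (p : Fin 3 → ℝ) : ℝ := if a = 0 then -(p 0) else p a

/-- The vector fields `Ω_{ab} = x_a ∂_b − x_b ∂_a`. -/
def Omg {E : Type*} [NormedAddCommGroup E] [NormedSpace ℝ E]
    (a b : Fin 3) (u : (Fin 3 → ℝ) → E) : (Fin 3 → ℝ) → E :=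
  fun p => Xc a p • pd b u p - Xc b p • pd a u p

/-- Minkowski metric coefficients `(η_{ab}) = diag(−1,1,1)`. -/
def eta (a b : Fin 3) : ℝ := if a = b then (if a = 0 then -1 else 1) else 0

/-- The family of vector fields `Z = (∂_t, ∂_1, ∂_2, Ω_{01}, Ω_{02}, Ω_{12})`. -/
def Zop {E : Type*} [NormedAddCommGroup E] [NormedSpace ℝ E] :
    Fin 6 → ((Fin 3 → ℝ) → E) → ((Fin 3 → ℝ) → E) :=
  ![pd 0, pd 1, pd 2, Omg 0 1, Omg 0 2, Omg 1 2]

/-- The Dirac operator `D_M = ∂_t + α₁∂_1 + α₂∂_2 + iMβ`. -/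
def DiracOp (M : ℝ) (α1 α2 β : Matrix (Fin 2) (Fin 2) ℂ)
    (u : (Fin 3 → ℝ) → Fin 2 → ℂ) : (Fin 3 → ℝ) → Fin 2 → ℂ :=
  fun p => pd 0 u p + α1.mulVec (pd 1 u p) + α2.mulVec (pd 2 u p)
    + (Complex.I * M) • β.mulVec (u p)

/-- The operator `D̄_M = ∂_t − (α₁∂_1 + α₂∂_2 + iMβ)`. -/
def DiracBar (M : ℝ) (α1 α2 β : Matrix (Fin 2) (Fin 2) ℂ)
    (u : (Fin 3 → ℝ) → Fin 2 → ℂ) : (Fin 3 → ℝ) → Fin 2 → ℂ :=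
  fun p => pd 0 u p - (α1.mulVec (pd 1 u p) + α2.mulVec (pd 2 u p)
    + (Complex.I * M) • β.mulVec (u p))

/-- Algebraic assumptions on the Dirac matrices: `α₁, α₂, β` are Hermitian, square to the
identity and pairwise anticommute. -/
def DiracMatrices (α1 α2 β : Matrix (Fin 2) (Fin 2) ℂ) : Prop :=
  α1.IsHermitian ∧ α2.IsHermitian ∧ β.IsHermitian ∧
  α1 * α1 = 1 ∧ α2 * α2 = 1 ∧ β * β = 1 ∧
  α1 * α2 + α2 * α1 = 0 ∧ α1 * β + β * α1 = 0 ∧ α2 * β + β * α2 = 0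

/-- The hermitian inner product `⟨u,v⟩_{ℂ²} = u† v`. -/
def innC2 (u v : Fin 2 → ℂ) : ℂ := ∑ i, (starRingEnd ℂ) (u i) * v i

/-- `(ψ, φ)` solves the Dirac–Klein–Gordon system
`D_M ψ = igφβψ`, `(□ + m²)φ = g⟨ψ, βψ⟩_{ℂ²}`. -/
def IsDKG (M m g : ℝ) (α1 α2 β : Matrix (Fin 2) (Fin 2) ℂ)
    (ψ : (Fin 3 → ℝ) → Fin 2 → ℂ) (φ : (Fin 3 → ℝ) → ℝ) : Prop :=
  (∀ p, DiracOp M α1 α2 β ψ p = (Complex.I * g * φ p) • β.mulVec (ψ p)) ∧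
  (∀ p, ((Box φ p + m ^ 2 * φ p : ℝ) : ℂ) = g * innC2 (ψ p) (β.mulVec (ψ p)))

/-- `∂^μ` for a spacetime multi-index of order `≤ 1`: `none` is the identity operator
(order `0`), and `some a` is `∂_a` (order `1`). -/
def pdOpt {E : Type*} [NormedAddCommGroup E] [NormedSpace ℝ E] :
    Option (Fin 3) → ((Fin 3 → ℝ) → E) → ((Fin 3 → ℝ) → E)
  | none => id
  | some a => pd a

section Vanishing

variable {D E F G : Type*} [NormedAddCommGroup D] [NormedSpace ℝ D]
  [NormedAddCommGroup E] [NormedSpace ℝ E] [NormedAddCommGroup F] [NormedSpace ℝ F]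
  [NormedAddCommGroup G] [NormedSpace ℝ G]

/-- `f` is smooth and its derivatives of order `< n` vanish at the origin. -/
def VanishesToOrder (n : ℕ) (f : D → E) : Prop :=
  ContDiff ℝ (⊤ : ℕ∞) f ∧ ∀ k < n, iteratedFDeriv ℝ k f 0 = 0

namespace VanishesToOrder

lemma clm (L : D →L[ℝ] E) : VanishesToOrder 1 L := by
  refine ⟨L.contDiff, fun k hk => ?_⟩
  obtain rfl : k = 0 := by omega
  ext v
  simp

lemma add {n : ℕ} {f g : D → E} (hf : VanishesToOrder n f) (hg : VanishesToOrder n g) :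
    VanishesToOrder n (fun x => f x + g x) := by
  refine ⟨hf.1.add hg.1, fun k hk => ?_⟩
  have hk' : (k : WithTop ℕ∞) ≤ ((⊤ : ℕ∞) : WithTop ℕ∞) := by exact_mod_cast le_top
  change iteratedFDeriv ℝ k (f + g) 0 = 0
  rw [iteratedFDeriv_add_apply (hf.1.of_le hk').contDiffAt (hg.1.of_le hk').contDiffAt,
    hf.2 k hk, hg.2 k hk, add_zero]

lemma clm_comp {n : ℕ} {f : D → E} (L : E →L[ℝ] F) (hf : VanishesToOrder n f) :
    VanishesToOrder n (fun x => L (f x)) := by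
  refine ⟨L.contDiff.comp hf.1, fun k hk => ?_⟩
  have hk' : (k : WithTop ℕ∞) ≤ ((⊤ : ℕ∞) : WithTop ℕ∞) := by exact_mod_cast le_top
  change iteratedFDeriv ℝ k (L ∘ f) 0 = 0
  rw [L.iteratedFDeriv_comp_left hf.1.contDiffAt hk', hf.2 k hk]
  ext v
  simp

lemma const_smul {n : ℕ} {f : D → E} (c : ℝ) (hf : VanishesToOrder n f) :
    VanishesToOrder n (fun x => c • f x) :=
  hf.clm_comp (c • ContinuousLinearMap.id ℝ E)

lemma neg {n : ℕ} {f : D → E} (hf : VanishesToOrder n f) :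
    VanishesToOrder n (fun x => -f x) :=
  hf.clm_comp (-ContinuousLinearMap.id ℝ E)

lemma sub {n : ℕ} {f g : D → E} (hf : VanishesToOrder n f) (hg : VanishesToOrder n g) :
    VanishesToOrder n (fun x => f x - g x) := by
  simpa only [sub_eq_add_neg] using hf.add hg.neg

lemma sum {ι : Type*} {n : ℕ} (s : Finset ι) {f : ι → D → E}
    (hf : ∀ i, VanishesToOrder n (f i)) : VanishesToOrder n (fun x => ∑ i ∈ s, f i x) := by
  classical
  induction s using Finset.induction_on with
  | empty =>
    simp only [Finset.sum_empty]
    exact ⟨contDiff_const, fun k _ => by simp⟩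
  | insert i s his ih =>
    simp only [Finset.sum_insert his]
    exact (hf i).add ih

lemma bilin {m n k : ℕ} (B : E →L[ℝ] F →L[ℝ] G) {f : D → E} {g : D → F}
    (hf : VanishesToOrder m f) (hg : VanishesToOrder n g) (hk : k ≤ m + n) :
    VanishesToOrder k (fun x => B (f x) (g x)) := by
  refine ⟨B.isBoundedBilinearMap.contDiff.comp (hf.1.prodMk hg.1), fun j hj => ?_⟩
  have hj' : (j : WithTop ℕ∞) ≤ ((⊤ : ℕ∞) : WithTop ℕ∞) := by exact_mod_cast le_top
  have h := B.norm_iteratedFDeriv_le_of_bilinear hf.1 hg.1 0 hj'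
  rw [Finset.sum_eq_zero, mul_zero] at h
  · exact norm_le_zero_iff.1 h
  · intro i hi
    rw [Finset.mem_range] at hi
    rcases lt_or_ge i m with him | him
    · simp [hf.2 i him]
    · simp [hg.2 (j - i) (by omega)]

lemma smul {m n k : ℕ} {f : D → ℝ} {g : D → E}
    (hf : VanishesToOrder m f) (hg : VanishesToOrder n g) (hk : k ≤ m + n) :
    VanishesToOrder k (fun x => f x • g x) :=
  hf.bilin (ContinuousLinearMap.lsmul ℝ ℝ) hg hk

end VanishesToOrder

end Vanishing

section PartialDerivatives

variable {E F G : Type*} [NormedAddCommGroup E] [NormedSpace ℝ E]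
  [NormedAddCommGroup F] [NormedSpace ℝ F] [NormedAddCommGroup G] [NormedSpace ℝ G]
  {u v : (Fin 3 → ℝ) → E} {w : (Fin 3 → ℝ) → F} {f : (Fin 3 → ℝ) → ℝ}

lemma contDiff_pd (hu : ContDiff ℝ (⊤ : ℕ∞) u) (a : Fin 3) :
    ContDiff ℝ (⊤ : ℕ∞) (pd a u) := by
  have h : ContDiff ℝ (⊤ : ℕ∞) (fderiv ℝ u) := hu.fderiv_right (by simp)
  exact h.clm_apply contDiff_const

lemma pd_add (hu : Differentiable ℝ u) (hv : Differentiable ℝ v) (a : Fin 3) :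
    pd a (fun q => u q + v q) = fun q => pd a u q + pd a v q := by
  funext q
  simp only [pd]
  rw [fderiv_fun_add (hu q) (hv q)]
  simp

lemma pd_sub (hu : Differentiable ℝ u) (hv : Differentiable ℝ v) (a : Fin 3) :
    pd a (fun q => u q - v q) = fun q => pd a u q - pd a v q := by
  funext q
  simp only [pd]
  rw [fderiv_fun_sub (hu q) (hv q)]
  simp

lemma pd_clm (L : E →L[ℝ] F) (hu : Differentiable ℝ u) (a : Fin 3) :
    pd a (fun q => L (u q)) = fun q => L (pd a u q) := by
  funext q
  have h := L.hasFDerivAt.comp q (hu q).hasFDerivAt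
  simp only [pd]
  erw [h.fderiv]
  simp

lemma pd_const_smul (c : ℝ) (hu : Differentiable ℝ u) (a : Fin 3) :
    pd a (fun q => c • u q) = fun q => c • pd a u q :=
  pd_clm (c • ContinuousLinearMap.id ℝ E) hu a

lemma pd_sum {ι : Type*} (s : Finset ι) {u : ι → (Fin 3 → ℝ) → E}
    (hu : ∀ i, Differentiable ℝ (u i)) (a : Fin 3) :
    pd a (fun q => ∑ i ∈ s, u i q) = fun q => ∑ i ∈ s, pd a (u i) q := by
  funext q
  simp only [pd]
  rw [fderiv_fun_sum (fun i _ => hu i q)]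
  simp

lemma pd_bilin (B : E →L[ℝ] F →L[ℝ] G) (hu : Differentiable ℝ u) (hw : Differentiable ℝ w)
    (a : Fin 3) :
    pd a (fun q => B (u q) (w q)) = fun q => B (pd a u q) (w q) + B (u q) (pd a w q) := by
  funext q
  simp only [pd]
  rw [(B.hasFDerivAt_of_bilinear (hu q).hasFDerivAt (hw q).hasFDerivAt).fderiv]
  simp [add_comm]

lemma pd_smul (hf : Differentiable ℝ f) (hu : Differentiable ℝ u) (a : Fin 3) :
    pd a (fun q => f q • u q) = fun q => pd a f q • u q + f q • pd a u q :=
  pd_bilin (ContinuousLinearMap.lsmul ℝ ℝ) hf hu a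

lemma pd_comm (hu : ContDiff ℝ (⊤ : ℕ∞) u) (a b : Fin 3) :
    pd a (pd b u) = pd b (pd a u) := by
  have h : Differentiable ℝ (fderiv ℝ u) :=
    (hu.fderiv_right (m := (⊤ : ℕ∞)) (by simp)).differentiable (by simp)
  have key (c : Fin 3) (x y : Fin 3 → ℝ) :
      fderiv ℝ (fun q => fderiv ℝ u q y) x (Pi.single c 1)
        = fderiv ℝ (fderiv ℝ u) x (Pi.single c 1) y := by
    rw [fderiv_clm_apply (h x) (differentiableAt_const y)]
    simp
  funext q
  simp only [pd]
  erw [key a q (Pi.single b 1), key b q (Pi.single a 1)]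
  exact (hu.contDiffAt.isSymmSndFDerivAt
    (by simpa using WithTop.coe_le_coe.2 (le_top (a := (2 : ℕ∞))))) _ _

/-- The signs `(1, -1, -1)` of the coefficients of `□`. -/
def boxSign : Fin 3 → ℝ := ![1, -1, -1]

lemma box_eq_sum (u : (Fin 3 → ℝ) → E) (p : Fin 3 → ℝ) :
    Box u p = ∑ a, boxSign a • pd a (pd a u) p := by
  simp [Box, Fin.sum_univ_three, boxSign, sub_eq_add_neg]

lemma box_add (hu : ContDiff ℝ (⊤ : ℕ∞) u) (hv : ContDiff ℝ (⊤ : ℕ∞) v) (p : Fin 3 → ℝ) :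
    Box (fun q => u q + v q) p = Box u p + Box v p := by
  have hu' := fun a => (contDiff_pd hu a).differentiable (by simp)
  have hv' := fun a => (contDiff_pd hv a).differentiable (by simp)
  simp only [Box, pd_add (hu.differentiable (by simp)) (hv.differentiable (by simp)),
    pd_add (hu' _) (hv' _)]
  abel

lemma box_const_smul (c : ℝ) (hu : ContDiff ℝ (⊤ : ℕ∞) u) (p : Fin 3 → ℝ) :
    Box (fun q => c • u q) p = c • Box u p := by
  have hu' := fun a => (contDiff_pd hu a).differentiable (by simp)
  simp only [Box, pd_const_smul c (hu.differentiable (by simp)), pd_const_smul c (hu' _)]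
  module

lemma pd_box (hu : ContDiff ℝ (⊤ : ℕ∞) u) (a : Fin 3) : pd a (Box u) = Box (pd a u) := by
  have hu' := fun b => (contDiff_pd (contDiff_pd hu b) b).differentiable (by simp)
  have h : Box u = fun q => pd 0 (pd 0 u) q - pd 1 (pd 1 u) q - pd 2 (pd 2 u) q := rfl
  have hb : Box (pd a u)
      = fun q => pd 0 (pd 0 (pd a u)) q - pd 1 (pd 1 (pd a u)) q - pd 2 (pd 2 (pd a u)) q := rfl
  rw [h, hb, pd_sub (u := fun q => pd 0 (pd 0 u) q - pd 1 (pd 1 u) q) ((hu' 0).sub (hu' 1)) (hu' 2),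
    pd_sub (hu' 0) (hu' 1)]
  simp only [pd_comm (contDiff_pd hu _) a, pd_comm hu a]

lemma box_bilin (B : E →L[ℝ] E →L[ℝ] G) (hu : ContDiff ℝ (⊤ : ℕ∞) u) (p : Fin 3 → ℝ) :
    Box (fun q => B (u q) (u q)) p = B (Box u p) (u p) + B (u p) (Box u p)
      + (2 : ℝ) • ∑ a, boxSign a • B (pd a u p) (pd a u p) := by
  have hd := hu.differentiable (by simp)
  have hu' := fun a => (contDiff_pd hu a).differentiable (by simp)
  have h (a : Fin 3) : pd a (pd a (fun q => B (u q) (u q))) = fun q =>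
      B (pd a (pd a u) q) (u q) + B (pd a u q) (pd a u q)
        + (B (pd a u q) (pd a u q) + B (u q) (pd a (pd a u) q)) := by
    rw [pd_bilin B hd hd, pd_add, pd_bilin B (hu' a) hd, pd_bilin B hd (hu' a)]
    · exact fun q => B.isBoundedBilinearMap.differentiableAt _ |>.comp q ((hu' a q).prodMk (hd q))
    · exact fun q => B.isBoundedBilinearMap.differentiableAt _ |>.comp q ((hd q).prodMk (hu' a q))
  simp only [Box, h, map_sub, _root_.sub_apply, Fin.sum_univ_three, boxSign]
  simp
  module

end PartialDerivatives

section NormalForm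

variable {V W : Type*} [NormedAddCommGroup V] [NormedSpace ℝ V]
  [NormedAddCommGroup W] [NormedSpace ℝ W]

/-- Second-order jets of a `V`-valued field and a real scalar field. -/
abbrev JetSpace (V : Type*) : Type _ :=
  ((Option (Fin 3) × Option (Fin 3)) → V) × ((Option (Fin 3) × Option (Fin 3)) → ℝ)

/-- The second-order jet of `(ψ, φ)` at `p`. -/
def jet (ψ : (Fin 3 → ℝ) → V) (φ : (Fin 3 → ℝ) → ℝ) (p : Fin 3 → ℝ) : JetSpace V :=
  (fun μν => pdOpt μν.1 (pdOpt μν.2 ψ) p, fun μν => pdOpt μν.1 (pdOpt μν.2 φ) p)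

/-- The nonlinearity `2Mgφψ − g²φ²ψ + ∑ₐ (∂ₐφ) Kₐψ` of the squared Dirac equation. -/
def source (M g : ℝ) (K : Fin 3 → V →L[ℝ] V) (J : JetSpace V) : V :=
  (2 * M * g) • (J.2 (none, none) • J.1 (none, none))
    - g ^ 2 • (J.2 (none, none) • (J.2 (none, none) • J.1 (none, none)))
    + ∑ a, J.2 (some a, none) • K a (J.1 (none, none))

/-- The total derivative `∂ₐ` of `source`. -/
def sourceDeriv (M g : ℝ) (K : Fin 3 → V →L[ℝ] V) (a : Fin 3) (J : JetSpace V) : V :=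
  (2 * M * g) • (J.2 (some a, none) • J.1 (none, none) + J.2 (none, none) • J.1 (some a, none))
    - g ^ 2 • (J.2 (some a, none) • (J.2 (none, none) • J.1 (none, none))
      + J.2 (none, none) •
        (J.2 (some a, none) • J.1 (none, none) + J.2 (none, none) • J.1 (some a, none)))
    + ∑ b, (J.2 (some a, some b) • K b (J.1 (none, none))
      + J.2 (some b, none) • K b (J.1 (some a, none)))

lemma vanishesToOrder_jet_fst (i : Option (Fin 3) × Option (Fin 3)) :
    VanishesToOrder 1 (fun J : JetSpace V => J.1 i) :=
  VanishesToOrder.clm ((ContinuousLinearMap.proj (R := ℝ) (φ := fun _ => V) i).comp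
    (ContinuousLinearMap.fst ℝ (Option (Fin 3) × Option (Fin 3) → V)
      (Option (Fin 3) × Option (Fin 3) → ℝ)))

lemma vanishesToOrder_jet_snd (i : Option (Fin 3) × Option (Fin 3)) :
    VanishesToOrder 1 (fun J : JetSpace V => J.2 i) :=
  VanishesToOrder.clm ((ContinuousLinearMap.proj (R := ℝ) (φ := fun _ => ℝ) i).comp
    (ContinuousLinearMap.snd ℝ (Option (Fin 3) × Option (Fin 3) → V)
      (Option (Fin 3) × Option (Fin 3) → ℝ)))

lemma vanishesToOrder_source (M g : ℝ) (K : Fin 3 → V →L[ℝ] V) :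
    VanishesToOrder 2 (source M g K) := by
  have h1 := vanishesToOrder_jet_fst (V := V)
  have h2 := vanishesToOrder_jet_snd (V := V)
  have h (i j) : VanishesToOrder 2 (fun J : JetSpace V => J.2 i • J.1 j) :=
    (h2 i).smul (h1 j) le_rfl
  exact (((h _ _).const_smul _).sub (((h2 _).smul (h _ _) (by norm_num)).const_smul _)).add
    (.sum _ fun a => (h2 _).smul ((h1 _).clm_comp (K a)) le_rfl)

lemma vanishesToOrder_sourceDeriv (M g : ℝ) (K : Fin 3 → V →L[ℝ] V) (a : Fin 3) :
    VanishesToOrder 2 (sourceDeriv M g K a) := by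
  have h1 := vanishesToOrder_jet_fst (V := V)
  have h2 := vanishesToOrder_jet_snd (V := V)
  have h (i j) : VanishesToOrder 2 (fun J : JetSpace V => J.2 i • J.1 j) :=
    (h2 i).smul (h1 j) le_rfl
  exact ((((h _ _).add (h _ _)).const_smul _).sub
    ((((h2 _).smul (h _ _) (by norm_num)).add
      ((h2 _).smul ((h _ _).add (h _ _)) (by norm_num))).const_smul _)).add
    (.sum _ fun b => ((h2 _).smul ((h1 _).clm_comp (K b)) le_rfl).add
      ((h2 _).smul ((h1 _).clm_comp (K b)) le_rfl))

variable {ψ : (Fin 3 → ℝ) → V} {φ : (Fin 3 → ℝ) → ℝ}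

lemma pd_source_jet (hψ : ContDiff ℝ (⊤ : ℕ∞) ψ) (hφ : ContDiff ℝ (⊤ : ℕ∞) φ)
    (M g : ℝ) (K : Fin 3 → V →L[ℝ] V) (a : Fin 3) (p : Fin 3 → ℝ) :
    pd a (fun q => source M g K (jet ψ φ q)) p = sourceDeriv M g K a (jet ψ φ p) := by
  have dψ := hψ.differentiable (by simp)
  have dφ := hφ.differentiable (by simp)
  have dφ' := fun b => (contDiff_pd hφ b).differentiable (by simp)
  have d1 : Differentiable ℝ fun q => φ q • ψ q := dφ.smul dψ
  have d2 : Differentiable ℝ fun q => φ q • (φ q • ψ q) := dφ.smul d1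
  have dK : ∀ b, Differentiable ℝ fun q => K b (ψ q) := fun b => (K b).differentiable.comp dψ
  have d3 : ∀ b, Differentiable ℝ fun q => pd b φ q • K b (ψ q) := fun b => (dφ' b).smul (dK b)
  change pd a (fun q => ((2 * M * g) • (φ q • ψ q) - g ^ 2 • (φ q • (φ q • ψ q)))
    + ∑ b, pd b φ q • K b (ψ q)) p = _
  rw [pd_add (u := fun q => (2 * M * g) • (φ q • ψ q) - g ^ 2 • (φ q • (φ q • ψ q)))
      ((d1.const_smul _).sub (d2.const_smul _)) (.fun_sum fun b _ => d3 b),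
    pd_sub (u := fun q => (2 * M * g) • (φ q • ψ q)) (v := fun q => g ^ 2 • (φ q • (φ q • ψ q)))
      (d1.const_smul _) (d2.const_smul _), pd_const_smul _ d1, pd_const_smul _ d2,
    pd_smul dφ d1, pd_smul dφ dψ, pd_sum _ d3]
  simp only [pd_smul (dφ' _) (dK _), pd_clm (K _) dψ]
  rfl

lemma box_eq_source_of_dirac (hψ : ContDiff ℝ (⊤ : ℕ∞) ψ) (hφ : ContDiff ℝ (⊤ : ℕ∞) φ)
    (M g : ℝ) (A₁ A₂ N : V →L[ℝ] V)
    (h11 : ∀ v, A₁ (A₁ v) = v) (h22 : ∀ v, A₂ (A₂ v) = v) (hNN : ∀ v, N (N v) = -v)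
    (h12 : ∀ v, A₁ (A₂ v) = -A₂ (A₁ v)) (h1N : ∀ v, A₁ (N v) = -N (A₁ v))
    (h2N : ∀ v, A₂ (N v) = -N (A₂ v))
    (h : ∀ q, pd 0 ψ q = -A₁ (pd 1 ψ q) - A₂ (pd 2 ψ q) - N ((M - g * φ q) • ψ q))
    (p : Fin 3 → ℝ) :
    Box ψ p = -M ^ 2 • ψ p
      + source M g ![g • N, g • (N.comp A₁), g • (N.comp A₂)] (jet ψ φ p) := by
  have dψ := hψ.differentiable (by simp)
  have dφ := hφ.differentiable (by simp)
  have dψ' := fun b => (contDiff_pd hψ b).differentiable (by simp)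
  have dc : Differentiable ℝ (fun q => M - g * φ q) := by fun_prop
  have dw : Differentiable ℝ fun q => (M - g * φ q) • ψ q := dc.smul dψ
  have d1 : Differentiable ℝ fun q => -A₁ (pd 1 ψ q) := ((-A₁).differentiable.comp (dψ' 1))
  have d2 : Differentiable ℝ fun q => A₂ (pd 2 ψ q) := (A₂.differentiable.comp (dψ' 2))
  have d3 : Differentiable ℝ fun q => N ((M - g * φ q) • ψ q) := N.differentiable.comp dw
  have hc (a : Fin 3) : pd a (fun q => M - g * φ q) = fun q => -g * pd a φ q := by
    rw [pd_sub (differentiable_const M) (dφ.const_mul g)]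
    funext q
    have := congrFun (pd_const_smul g dφ a) q
    simp only [smul_eq_mul] at this
    rw [this]
    simp [pd]
  have hpd (a : Fin 3) : pd a (pd 0 ψ) = fun q => -A₁ (pd a (pd 1 ψ) q) - A₂ (pd a (pd 2 ψ) q)
      - N ((-g * pd a φ q) • ψ q + (M - g * φ q) • pd a ψ q) := by
    rw [funext h, pd_sub (u := fun q => -A₁ (pd 1 ψ q) - A₂ (pd 2 ψ q)) (d1.sub d2) d3,
      pd_sub d1 d2, pd_clm N dw, pd_clm A₂ (dψ' 2), pd_smul dc dψ, hc]
    have := pd_clm (-A₁) (dψ' 1) a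
    simp only [_root_.neg_apply] at this
    rw [this]
  have e1 : pd 0 (pd 1 ψ) = pd 1 (pd 0 ψ) := pd_comm hψ 0 1
  have e2 : pd 0 (pd 2 ψ) = pd 2 (pd 0 ψ) := pd_comm hψ 0 2
  have e3 : pd 2 (pd 1 ψ) = pd 1 (pd 2 ψ) := pd_comm hψ 2 1
  simp only [Box, hpd 0, e1, e2, hpd 1, hpd 2, e3, h p]
  simp only [source, jet, pdOpt, id, Fin.sum_univ_three, map_add, map_sub, map_neg, map_smul,
    h11, h22, hNN, h12, h1N, h2N, Matrix.cons_val_zero, Matrix.cons_val_one, Matrix.cons_val,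
    _root_.smul_apply, ContinuousLinearMap.comp_apply]
  module

/-- The cubic remainder of the normal form, with coefficients `k₀`, `k₁`. -/
def cubicRemainder (B : V →L[ℝ] V →L[ℝ] W) (M g k₀ k₁ : ℝ) (K : Fin 3 → V →L[ℝ] V)
    (J : JetSpace V) : W :=
  -(k₀ • (B (source M g K J) (J.1 (none, none)) + B (J.1 (none, none)) (source M g K J))
    + k₁ • (∑ a, boxSign a • (B (sourceDeriv M g K a J) (J.1 (some a, none))
      + B (J.1 (some a, none)) (sourceDeriv M g K a J)))
    + (2 * k₁) • (B (source M g K J) (source M g K J)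
      - M ^ 2 • (B (source M g K J) (J.1 (none, none))
        + B (J.1 (none, none)) (source M g K J))))

lemma vanishesToOrder_cubicRemainder (B : V →L[ℝ] V →L[ℝ] W) (M g k₀ k₁ : ℝ)
    (K : Fin 3 → V →L[ℝ] V) : VanishesToOrder 3 (cubicRemainder B M g k₀ k₁ K) := by
  have h1 := vanishesToOrder_jet_fst (V := V)
  have hs := vanishesToOrder_source M g K
  have hd := vanishesToOrder_sourceDeriv M g K
  have h := (hs.bilin B (h1 (none, none)) le_rfl).add ((h1 (none, none)).bilin B hs le_rfl)
  exact (((h.const_smul k₀).add ((VanishesToOrder.sum Finset.univ fun a =>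
    (((hd a).bilin B (h1 (some a, none)) le_rfl).add
      ((h1 (some a, none)).bilin B (hd a) le_rfl)).const_smul (boxSign a)).const_smul k₁)).add
    (((hs.bilin B hs (by norm_num)).sub (h.const_smul (M ^ 2))).const_smul (2 * k₁))).neg

lemma bilin_normal_form (hψ : ContDiff ℝ (⊤ : ℕ∞) ψ) (hφ : ContDiff ℝ (⊤ : ℕ∞) φ)
    (B : V →L[ℝ] V →L[ℝ] W) (M m g k₀ k₁ : ℝ) (K : Fin 3 → V →L[ℝ] V)
    (h : ∀ q, Box ψ q = -M ^ 2 • ψ q + source M g K (jet ψ φ q))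
    (hk₀ : k₀ * (m ^ 2 - 2 * M ^ 2) + 2 * M ^ 4 * k₁ = g)
    (hk₁ : 2 * k₀ + k₁ * (m ^ 2 - 2 * M ^ 2) = 0) (p : Fin 3 → ℝ) :
    g • B (ψ p) (ψ p)
      = (Box (fun q => k₀ • B (ψ q) (ψ q)
            + k₁ • ∑ a, boxSign a • B (pd a ψ q) (pd a ψ q)) p
          + m ^ 2 • (k₀ • B (ψ p) (ψ p) + k₁ • ∑ a, boxSign a • B (pd a ψ p) (pd a ψ p)))
        + (∑ a, ∑ b, (2 * k₁ * boxSign a * boxSign b) •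
            (B (pd a (pd a ψ) p) (pd b (pd b ψ) p) - B (pd b (pd a ψ) p) (pd a (pd b ψ) p)))
        + cubicRemainder B M g k₀ k₁ K (jet ψ φ p) := by
  have hB {u : (Fin 3 → ℝ) → V} (hu : ContDiff ℝ (⊤ : ℕ∞) u) :
      ContDiff ℝ (⊤ : ℕ∞) fun q => B (u q) (u q) :=
    B.isBoundedBilinearMap.contDiff.comp (hu.prodMk hu)
  have hψ' := fun a => contDiff_pd hψ a
  have hs (a : Fin 3) := (hB (hψ' a)).const_smul (boxSign a)
  have hS : ContDiff ℝ (⊤ : ℕ∞) fun q => ∑ a, boxSign a • B (pd a ψ q) (pd a ψ q) :=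
    ContDiff.sum fun a _ => hs a
  have hdS : ContDiff ℝ (⊤ : ℕ∞) fun q => source M g K (jet ψ φ q) := by
    have : (fun q => source M g K (jet ψ φ q)) = fun q => Box ψ q + M ^ 2 • ψ q := by
      funext q
      rw [h q]
      module
    rw [this]
    have hb := fun b => contDiff_pd (hψ' b) b
    exact (((hb 0).sub (hb 1)).sub (hb 2)).add (hψ.const_smul _)
  have hpd (a : Fin 3) : Box (pd a ψ) p
      = -M ^ 2 • pd a ψ p + sourceDeriv M g K a (jet ψ φ p) := by
    rw [← pd_box hψ, funext h, pd_add (u := fun q => -M ^ 2 • ψ q)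
      ((hψ.differentiable (by simp)).const_smul _) (hdS.differentiable (by simp)), pd_const_smul _ (hψ.differentiable (by simp))]
    exact congrArg (_ + ·) (pd_source_jet hψ hφ M g K a p)
  have hBoxS : Box (fun q => ∑ a, boxSign a • B (pd a ψ q) (pd a ψ q)) p
      = ∑ a, boxSign a • Box (fun q => B (pd a ψ q) (pd a ψ q)) p := by
    simp only [Fin.sum_univ_three] at hS ⊢
    rw [box_add (u := fun q => boxSign 0 • B (pd 0 ψ q) (pd 0 ψ q)
        + boxSign 1 • B (pd 1 ψ q) (pd 1 ψ q)) ((hs 0).add (hs 1)) (hs 2),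
      box_add (hs 0) (hs 1)]
    simp only [box_const_smul _ (hB (hψ' _))]
  have hnull : (∑ a, ∑ b, (2 * k₁ * boxSign a * boxSign b) •
        (B (pd a (pd a ψ) p) (pd b (pd b ψ) p) - B (pd b (pd a ψ) p) (pd a (pd b ψ) p)))
      = (2 * k₁) • (B (Box ψ p) (Box ψ p)
        - ∑ a, boxSign a • ∑ b, boxSign b • B (pd b (pd a ψ) p) (pd b (pd a ψ) p)) := by
    simp only [box_eq_sum, Fin.sum_univ_three, map_add, map_smul, _root_.add_apply,
      _root_.smul_apply, pd_comm hψ 1 0, pd_comm hψ 2 0, pd_comm hψ 2 1]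
    module
  rw [hnull, box_add ((hB hψ).const_smul _) (hS.const_smul _), box_const_smul _ (hB hψ),
    box_const_smul _ hS, hBoxS]
  simp only [box_bilin B hψ, box_bilin B (hψ' _), hpd, h p]
  have hg : g • B (ψ p) (ψ p) = (k₀ * (m ^ 2 - 2 * M ^ 2) + 2 * M ^ 4 * k₁) • B (ψ p) (ψ p)
      + (2 * k₀ + k₁ * (m ^ 2 - 2 * M ^ 2)) • ∑ a, boxSign a • B (pd a ψ p) (pd a ψ p) := by
    rw [hk₀, hk₁, zero_smul, add_zero]
  rw [hg]
  have j0 : (jet ψ φ p).1 (none, none) = ψ p := rfl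
  have j1 (a : Fin 3) : (jet ψ φ p).1 (some a, none) = pd a ψ p := rfl
  simp only [cubicRemainder, j0, j1, map_add, map_smul, _root_.add_apply, _root_.smul_apply,
    Fin.sum_univ_three]
  module

end NormalForm

section Dirac

/-- The sesquilinear form `(u, v) ↦ ⟨u, βv⟩` as a real bilinear map. -/
def diracForm (β : Matrix (Fin 2) (Fin 2) ℂ) :
    (Fin 2 → ℂ) →L[ℝ] (Fin 2 → ℂ) →L[ℝ] ℂ :=
  LinearMap.toContinuousBilinearMap
    (LinearMap.mk₂ ℝ (fun u v => innC2 u (β.mulVec v))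
      (fun u u' v => by simp [innC2]; ring)
      (fun c u v => by simp [innC2]; ring)
      (fun u v v' => by simp [innC2, Matrix.mulVec_add]; ring)
      (fun c u v => by simp [innC2, Matrix.mulVec_smul]; ring))

lemma diracForm_apply (β : Matrix (Fin 2) (Fin 2) ℂ) (u v : Fin 2 → ℂ) :
    diracForm β u v = innC2 u (β.mulVec v) := rfl

lemma diracForm_im_swap {β : Matrix (Fin 2) (Fin 2) ℂ} (hβ : β.IsHermitian)
    (u v : Fin 2 → ℂ) : (diracForm β v u).im = -(diracForm β u v).im := by
  have h : diracForm β v u = (starRingEnd ℂ) (diracForm β u v) := by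
    have h' (i j) : (starRingEnd ℂ) (β i j) = β j i := hβ.apply j i
    simp only [diracForm_apply, innC2, Matrix.mulVec, dotProduct, Fin.sum_univ_two, map_add,
      map_mul, h', Complex.conj_conj]
    ring
  rw [h, Complex.conj_im]

/-- Multiplication by a complex matrix as a continuous real-linear map. -/
def mulVecReal (A : Matrix (Fin 2) (Fin 2) ℂ) : (Fin 2 → ℂ) →L[ℝ] (Fin 2 → ℂ) :=
  LinearMap.toContinuousLinearMap (A.mulVecLin.restrictScalars ℝ)

lemma mulVecReal_apply (A : Matrix (Fin 2) (Fin 2) ℂ) (v : Fin 2 → ℂ) :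
    mulVecReal A v = A.mulVec v := rfl

lemma cubicRemainder_im {V : Type*} [NormedAddCommGroup V] [NormedSpace ℝ V]
    {B : V →L[ℝ] V →L[ℝ] ℂ} (hB : ∀ u v, (B v u).im = -(B u v).im)
    (M g k₀ k₁ : ℝ) (K : Fin 3 → V →L[ℝ] V) (J : JetSpace V) :
    (cubicRemainder B M g k₀ k₁ K J).im = 0 := by
  have h (u v : V) : (B u v).im + (B v u).im = 0 := by rw [hB u v, add_neg_cancel]
  have h' (u : V) : (B u u).im = 0 := by linarith [hB u u]
  simp only [cubicRemainder, Complex.neg_im, Complex.add_im, Complex.sub_im, Complex.smul_im,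
    Complex.im_sum, h, h', smul_zero, Finset.sum_const_zero, add_zero, sub_zero, neg_zero]

/-- The coefficients `c'` of the quadratic correction. -/
def correctionCoeff (k₀ k₁ : ℝ) : Option (Fin 3) → Option (Fin 3) → ℝ
  | none, none => k₀
  | some a, some b => if a = b then k₁ * boxSign a else 0
  | _, _ => 0

/-- The coefficients `d'` of the null forms. -/
def nullFormCoeff (k : ℝ) (a b : Fin 3) : Option (Fin 3) → Option (Fin 3) → ℝ
  | some i, some j => if i = a ∧ j = b then k * boxSign a * boxSign b else 0
  | _, _ => 0

variable {W : Type*} [AddCommGroup W] [Module ℝ W]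

lemma sum_correctionCoeff (k₀ k₁ : ℝ) (F : Option (Fin 3) → Option (Fin 3) → W) :
    ∑ μ, ∑ ν, correctionCoeff k₀ k₁ μ ν • F μ ν
      = k₀ • F none none + k₁ • ∑ a, boxSign a • F (some a) (some a) := by
  simp [Fintype.sum_option, correctionCoeff, ite_smul, Finset.smul_sum, mul_smul]

lemma sum_nullFormCoeff (k : ℝ) (a b : Fin 3) (F : Option (Fin 3) → Option (Fin 3) → W) :
    ∑ μ, ∑ ν, nullFormCoeff k a b μ ν • F μ ν
      = (k * boxSign a * boxSign b) • F (some a) (some b) := by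
  simp [Fintype.sum_option, nullFormCoeff, ite_smul, ite_and]

lemma box_eq_source_of_isDKG {M m g : ℝ} {α1 α2 β : Matrix (Fin 2) (Fin 2) ℂ}
    (hmat : DiracMatrices α1 α2 β) {ψ : (Fin 3 → ℝ) → Fin 2 → ℂ} {φ : (Fin 3 → ℝ) → ℝ}
    (hψ : ContDiff ℝ (⊤ : ℕ∞) ψ) (hφ : ContDiff ℝ (⊤ : ℕ∞) φ)
    (h : IsDKG M m g α1 α2 β ψ φ) (p : Fin 3 → ℝ) :
    Box ψ p = -M ^ 2 • ψ p + source M g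
      ![g • mulVecReal (Complex.I • β),
        g • (mulVecReal (Complex.I • β)).comp (mulVecReal α1),
        g • (mulVecReal (Complex.I • β)).comp (mulVecReal α2)] (jet ψ φ p) := by
  obtain ⟨-, -, -, h11, h22, hββ, h12, h1β, h2β⟩ := hmat
  rw [add_eq_zero_iff_eq_neg] at h12 h1β h2β
  have hD (q : Fin 3 → ℝ) : pd 0 ψ q = -mulVecReal α1 (pd 1 ψ q) - mulVecReal α2 (pd 2 ψ q)
      - mulVecReal (Complex.I • β) ((M - g * φ q) • ψ q) := by
    have hq := h.1 q
    simp only [DiracOp] at hq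
    have hs : ((M - g * φ q) • ψ q : Fin 2 → ℂ) = ((M : ℂ) - g * φ q) • ψ q := by
      ext i
      simp
    simp only [mulVecReal_apply, hs, Matrix.smul_mulVec, Matrix.mulVec_smul]
    linear_combination (norm := module) hq
  refine box_eq_source_of_dirac hψ hφ M g _ _ _ (fun v => ?_) (fun v => ?_) (fun v => ?_)
    (fun v => ?_) (fun v => ?_) (fun v => ?_) hD p
  all_goals simp only [mulVecReal_apply, Matrix.mulVec_mulVec, Matrix.mulVec_smul, Matrix.smul_mul,
    h11, h22, hββ, h12, h1β, h2β, Matrix.one_mulVec, Matrix.neg_mulVec, smul_neg,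
    Matrix.smul_mulVec, smul_smul, Complex.I_mul_I, neg_smul, one_smul]

end Dirac

/-- normal form decomposition of the Klein–Gordon nonlinearity
`g⟨ψ, βψ⟩ = (□ + m²)Λ_{KG} + N_{KG} + R_{KG}` with
`Λ_{KG} = Σ c'_{μν} ⟨∂^μψ, β∂^νψ⟩`,
`N_{KG} = Σ d'_{abμν} (⟨∂_a∂^μψ, β∂_b∂^νψ⟩ − ⟨∂_b∂^μψ, β∂_a∂^νψ⟩)` and
`R_{KG} = G(second-order jets of (ψ, φ))`, where `G` is smooth, real-valued and
vanishes of cubic order at the origin. -/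
theorem normal_form_KG (M m g : ℝ) (hM : 0 < M) (hm : 0 < m) (hne : m ≠ 2 * M)
    (α1 α2 β : Matrix (Fin 2) (Fin 2) ℂ) (hmat : DiracMatrices α1 α2 β) :
    ∃ (c : Option (Fin 3) → Option (Fin 3) → ℝ)
      (d : Fin 3 → Fin 3 → Option (Fin 3) → Option (Fin 3) → ℝ)
      (G : ((Option (Fin 3) × Option (Fin 3)) → (Fin 2 → ℂ)) ×
             ((Option (Fin 3) × Option (Fin 3)) → ℝ) → ℝ),
      ContDiff ℝ (⊤ : ℕ∞) G ∧ G 0 = 0 ∧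
      iteratedFDeriv ℝ 1 G 0 = 0 ∧ iteratedFDeriv ℝ 2 G 0 = 0 ∧
      ∀ ψ φ, ContDiff ℝ (⊤ : ℕ∞) ψ → ContDiff ℝ (⊤ : ℕ∞) φ → IsDKG M m g α1 α2 β ψ φ →
        ∀ p, (g : ℂ) * innC2 (ψ p) (β.mulVec (ψ p))
          = (Box (fun q => ∑ μ : Option (Fin 3), ∑ ν : Option (Fin 3),
                c μ ν • innC2 (pdOpt μ ψ q) (β.mulVec (pdOpt ν ψ q))) p
              + m ^ 2 • (∑ μ : Option (Fin 3), ∑ ν : Option (Fin 3),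
                c μ ν • innC2 (pdOpt μ ψ p) (β.mulVec (pdOpt ν ψ p))))
            + (∑ a : Fin 3, ∑ b : Fin 3, ∑ μ : Option (Fin 3), ∑ ν : Option (Fin 3),
                d a b μ ν •
                  (innC2 (pd a (pdOpt μ ψ) p) (β.mulVec (pd b (pdOpt ν ψ) p))
                    - innC2 (pd b (pdOpt μ ψ) p) (β.mulVec (pd a (pdOpt ν ψ) p))))
            + (G (fun μν => pdOpt μν.1 (pdOpt μν.2 ψ) p,
                  fun μν => pdOpt μν.1 (pdOpt μν.2 φ) p) : ℂ) := by
  have hm0 : m ^ 2 ≠ 0 := by positivity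
  have hm1 : m ^ 2 - 4 * M ^ 2 ≠ 0 := by
    intro h
    have h' : (m - 2 * M) * (m + 2 * M) = 0 := by linear_combination h
    rcases mul_eq_zero.1 h' with h' | h'
    · exact hne (by linarith)
    · linarith
  set k₀ : ℝ := g / 2 * (1 / m ^ 2 + 1 / (m ^ 2 - 4 * M ^ 2)) with hk₀
  set k₁ : ℝ := g / (2 * M ^ 2) * (1 / m ^ 2 - 1 / (m ^ 2 - 4 * M ^ 2)) with hk₁
  set N := mulVecReal (Complex.I • β)
  set K := ![g • N, g • N.comp (mulVecReal α1), g • N.comp (mulVecReal α2)]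
  have hG : VanishesToOrder 3 (fun J => (cubicRemainder (diracForm β) M g k₀ k₁ K J).re) :=
    (vanishesToOrder_cubicRemainder (diracForm β) M g k₀ k₁ K).clm_comp Complex.reCLM
  refine ⟨correctionCoeff k₀ k₁, nullFormCoeff (2 * k₁), _, hG.1, ?_,
    hG.2 1 (by norm_num), hG.2 2 (by norm_num), fun ψ φ hψ hφ h p => ?_⟩
  · have h0 := congrArg (fun L => L 0) (hG.2 0 (by norm_num))
    simpa using h0
  have key := bilin_normal_form hψ hφ (diracForm β) M m g k₀ k₁ K
    (box_eq_source_of_isDKG hmat hψ hφ h)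
    (by rw [hk₀, hk₁]; field_simp; ring) (by rw [hk₀, hk₁]; field_simp; ring) p
  have him := cubicRemainder_im (diracForm_im_swap hmat.2.2.1) M g k₀ k₁ K (jet ψ φ p)
  have hre : ((cubicRemainder (diracForm β) M g k₀ k₁ K (jet ψ φ p)).re : ℂ)
      = cubicRemainder (diracForm β) M g k₀ k₁ K (jet ψ φ p) := by
    rw [← Complex.re_add_im (cubicRemainder (diracForm β) M g k₀ k₁ K (jet ψ φ p)), him]
    simp
  simp only [sum_correctionCoeff, sum_nullFormCoeff]
  rw [← hre, Complex.real_smul] at key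
  exact key

end
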